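/- arXiv:2401.08377 — 2 statements merged into one kernel-verified Lean document; each statement's English description precedes it below -/
import Mathlib

section
/- Let 𝒜, ℬ be rightward open MDPs with arities (m,0)→(l,0) and (l,0)→(n,0), and (L^𝒜,U^𝒜), (L^ℬ,U^ℬ) sound approximations. Define L := (A^{D(L^𝒜)⨟D(L^ℬ)}(i))_{i∈I^{𝒜⨟ℬ}} and U := (A^{D(U^𝒜)⨟D(U^ℬ)}(i))_{i∈I^{𝒜⨟ℬ}}. Then gap_∞(L,U) ≤ |O^𝒜| · gap_∞(L^𝒜, U^𝒜) + gap_∞(L^ℬ, U^ℬ). -/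
open scoped Classical ENNReal

namespace SD

/-- A Markov decision process with finite sets of states and actions: a partial
transition function assigning to a state and an action a probability
distribution over states. -/
structure MDP (S A : Type) : Type where
  P : S → A → Option (S → ℝ)

namespace MDP

variable {S A : Type} [Fintype S] [Fintype A]

/-- All defined transitions are genuine probability distributions. -/
def Proper (M : MDP S A) : Prop :=
  ∀ s a d, M.P s a = some d → (∀ s', 0 ≤ d s') ∧ ∑ s', d s' = 1

/-- The action `a` is enabled in `s`. -/
def enabled (M : MDP S A) (s : S) (a : A) : Prop := M.P s a ≠ none

/-- A state is terminal if no action is enabled in it. -/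
def terminal (M : MDP S A) (s : S) : Prop := ∀ a, M.P s a = none

/-- Transition probabilities. -/
noncomputable def prob (M : MDP S A) (s : S) (a : A) (s' : S) : ℝ :=
  (M.P s a).elim 0 fun d => d s'

end MDP

/-- A finite path of an MDP: a start state with a list of (action, next state) steps. -/
structure FinPath (S A : Type) : Type where
  start : S
  steps : List (A × S)

namespace FinPath

/-- The last state of a finite path. -/
def last {S A : Type} (π : FinPath S A) : S := (π.steps.map Prod.snd).getLastD π.start

/-- Extending a finite path by one step. -/
def snoc {S A : Type} (π : FinPath S A) (a : A) (s : S) : FinPath S A :=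
  ⟨π.start, π.steps ++ [(a, s)]⟩

end FinPath

namespace MDP

variable {S A : Type} [Fintype S] [Fintype A]

/-- Consistency of a sequence of steps with the transitions, from a given state. -/
def ConsistentFrom (M : MDP S A) : S → List (A × S) → Prop
  | _, [] => True
  | s, (a, s') :: l => M.prob s a s' ≠ 0 ∧ ConsistentFrom M s' l

/-- A finite path is consistent if every step has nonzero probability. -/
def Consistent (M : MDP S A) (π : FinPath S A) : Prop := M.ConsistentFrom π.start π.steps

end MDP

/-- A (history-dependent, stochastic) scheduler, given by its raw weights. -/
abbrev Sched (S A : Type) : Type := FinPath S A → A → ℝ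

namespace MDP

variable {S A : Type} [Fintype S] [Fintype A]

/-- `σ` is a scheduler for `M`: it assigns to every (consistent) finite path a
probability distribution over the actions enabled in its last state. -/
def IsSched (M : MDP S A) (σ : Sched S A) : Prop :=
  ∀ π : FinPath S A, M.Consistent π →
    (∀ a, 0 ≤ σ π a) ∧ (∀ a, σ π a ≠ 0 → M.enabled π.last a) ∧
      (¬M.terminal π.last → ∑ a, σ π a = 1)

end MDP

/-- Memoryless schedulers depend only on the last state of a path. -/
def Memoryless {S A : Type} (σ : Sched S A) : Prop :=
  ∀ π π' : FinPath S A, π.last = π'.last → σ π = σ π'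

/-- Deterministic schedulers choose Dirac distributions. -/
def Deterministic {S A : Type} (σ : Sched S A) : Prop := ∀ π a, σ π a = 0 ∨ σ π a = 1

/-- Deterministic memoryless (DM) schedulers. -/
def DM {S A : Type} (σ : Sched S A) : Prop := Memoryless σ ∧ Deterministic σ

namespace MDP

variable {S A : Type} [Fintype S] [Fintype A]

/-- Probability of visiting `T` within `n` steps (terminal states made absorbing),
starting from the history `π`, under the scheduler `σ`. -/
noncomputable def reachN (M : MDP S A) (σ : Sched S A) (T : Set S) :
    ℕ → FinPath S A → ℝ
  | 0, π => if π.last ∈ T then 1 else 0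
  | n + 1, π =>
      if π.last ∈ T then 1
      else ∑ a : A, σ π a * ∑ s' : S, M.prob π.last a s' * reachN M σ T n (π.snoc a s')

/-- `Pr^{M,σ}(s ⊨ ◇T)`: the probability, under the measure on infinite paths induced
by `σ` from `s` (terminal states made absorbing), of the paths that visit `T`; it is
the supremum of the bounded-horizon reachability probabilities. -/
noncomputable def Pr (M : MDP S A) (σ : Sched S A) (s : S) (T : Set S) : ℝ :=
  ⨆ n : ℕ, M.reachN σ T n ⟨s, []⟩

end MDP

/-- An open MDP: an MDP together with (totally ordered, given as lists) sets of
rightward/leftward entrances and exits. -/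
structure OMDP (S A : Type) : Type where
  M : MDP S A
  Ir : List S
  Il : List S
  Or : List S
  Ol : List S

namespace OMDP

variable {S A : Type}

/-- The entrances `I = I_r ∪ I_l`. -/
def entr (𝒜 : OMDP S A) : List S := 𝒜.Ir ++ 𝒜.Il

/-- The exits `O = O_r ∪ O_l`. -/
def exit (𝒜 : OMDP S A) : List S := 𝒜.Or ++ 𝒜.Ol

/-- The index type of exits. -/
abbrev ExitIdx (𝒜 : OMDP S A) : Type := {s : S // s ∈ 𝒜.exit}

/-- The index type of entrances. -/
abbrev EntrIdx (𝒜 : OMDP S A) : Type := {s : S // s ∈ 𝒜.entr}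

variable [Fintype S] [Fintype A]

/-- Well-formedness of an open MDP: the transitions are probability
distributions, the open ends are pairwise disjoint (each without duplicates),
and the exits are exactly the terminal states. -/
def WF (𝒜 : OMDP S A) : Prop :=
  𝒜.M.Proper ∧ (𝒜.Ir ++ 𝒜.Il ++ 𝒜.Or ++ 𝒜.Ol).Nodup ∧
    ∀ s : S, s ∈ 𝒜.exit ↔ 𝒜.M.terminal s

/-- `Pr^{𝒜,σ}(i ⊨ ◇O) ∈ ℝ^O`: the vector of reachability probabilities to each exit. -/
noncomputable def prVec (𝒜 : OMDP S A) (σ : Sched S A) (i : S) : 𝒜.ExitIdx → ℝ :=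
  fun j => 𝒜.M.Pr σ i {j.1}

/-- The set `A^𝒜(i)` of achievable points from `i`. -/
def achievable (𝒜 : OMDP S A) (i : S) : Set (𝒜.ExitIdx → ℝ) :=
  {p | ∃ σ : Sched S A, 𝒜.M.IsSched σ ∧ p ≤ 𝒜.prVec σ i}

/-- The set `A^{𝒜,Σ}(i)` of points achievable from `i` by schedulers in the class `C`. -/
def achievableBy (𝒜 : OMDP S A) (i : S) (C : Sched S A → Prop) : Set (𝒜.ExitIdx → ℝ) :=
  {p | ∃ σ : Sched S A, 𝒜.M.IsSched σ ∧ C σ ∧ p ≤ 𝒜.prVec σ i}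

/-- The Pareto curve `𝒮(𝒜, i)`: achievable points not strictly dominated by an
achievable point. -/
def pareto (𝒜 : OMDP S A) (i : S) : Set (𝒜.ExitIdx → ℝ) :=
  {p | p ∈ 𝒜.achievable i ∧ ∀ q ∈ 𝒜.achievable i, p ≤ q → q = p}

end OMDP

/-- Downward closure. -/
def dw {ι : Type} (X : Set (ι → ℝ)) : Set (ι → ℝ) := {p | ∃ q ∈ X, p ≤ q}

/-- Downward convex closure. -/
def dwConv {ι : Type} (X : Set (ι → ℝ)) : Set (ι → ℝ) := dw (convexHull ℝ X)

/-- Subdistributions on `ι`: nonnegative points with coordinate sum at most 1. -/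
def Subdist {ι : Type} [Fintype ι] (p : ι → ℝ) : Prop :=
  (∀ j, 0 ≤ p j) ∧ ∑ j, p j ≤ 1

end SD

namespace SD

namespace OMDP

variable {S A : Type} [Fintype S] [Fintype A]

/-- The actions of a shortcut oMDP for the family `B`: the union of the `B i`. -/
abbrev ShortAct (𝒜 : OMDP S A) (B : 𝒜.EntrIdx → Finset (𝒜.ExitIdx → ℝ)) : Type :=
  {p : 𝒜.ExitIdx → ℝ // ∃ i, p ∈ B i}

noncomputable instance instFintypeShortAct (𝒜 : OMDP S A)
    (B : 𝒜.EntrIdx → Finset (𝒜.ExitIdx → ℝ)) : Fintype (ShortAct 𝒜 B) := by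
  have h : {p : 𝒜.ExitIdx → ℝ | ∃ i, p ∈ B i}.Finite := by
    have he : {p : 𝒜.ExitIdx → ℝ | ∃ i, p ∈ B i} =
        ⋃ i, ((B i : Finset (𝒜.ExitIdx → ℝ)) : Set (𝒜.ExitIdx → ℝ)) := by
      ext p; simp
    rw [he]
    exact Set.finite_iUnion fun i => (B i).finite_toSet
  exact h.fintype

/-- The shortcut oMDP `D(B)` of a family `B = (B_i)_{i ∈ I}` of finite sets of
subdistributions on the exits: states are the entrances and exits of `𝒜`
together with a fresh sink `⋆` (encoded by `Option S`, with `⋆ = none`), actions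
are the points in the `B_i`, and from entrance `i` the action `p ∈ B_i` moves to
exit `o` with probability `p(o)` and to `⋆` with the remaining probability
`1 - Σ_o p(o)`. -/
noncomputable def shortcut (𝒜 : OMDP S A) (B : 𝒜.EntrIdx → Finset (𝒜.ExitIdx → ℝ)) :
    OMDP (Option S) (ShortAct 𝒜 B) where
  M := ⟨fun t a =>
    match t with
    | none => none
    | some s =>
        if _h : ∃ hs : s ∈ 𝒜.entr, a.1 ∈ B ⟨s, hs⟩ then
          some fun t' =>
            match t' with
            | none => 1 - ∑ j : 𝒜.ExitIdx, a.1 j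
            | some s' => ∑ j : 𝒜.ExitIdx, if j.1 = s' then a.1 j else 0
        else none⟩
  Ir := 𝒜.Ir.map some
  Il := 𝒜.Il.map some
  Or := 𝒜.Or.map some
  Ol := 𝒜.Ol.map some

end OMDP

/-- Transporting points in `ℝ^{O_𝒴}` to points in `ℝ^{O_𝒳}` along a map of exits. -/
def pullExit {S₁ A₁ S₂ A₂ : Type} (𝒳 : OMDP S₁ A₁) (𝒴 : OMDP S₂ A₂) (f : S₁ → S₂)
    (hf : ∀ s ∈ 𝒳.exit, f s ∈ 𝒴.exit) (p : 𝒴.ExitIdx → ℝ) : 𝒳.ExitIdx → ℝ :=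
  fun j => p ⟨f j.1, hf j.1 j.2⟩

end SD

namespace SD

namespace OMDP

variable {S₁ A₁ S₂ A₂ : Type}

/-- The sequential composition `𝒜 ⨟ ℬ` of type-matching open MDPs: the disjoint
union of the two oMDPs in which the `i`-th rightward exit of `𝒜` moves with
probability 1 to the `i`-th rightward entrance of `ℬ` and the `i`-th leftward
exit of `ℬ` moves with probability 1 to the `i`-th leftward entrance of `𝒜`;
its entrances are `(I_r^𝒜, I_l^ℬ)` and its exits are `(O_r^ℬ, O_l^𝒜)`. -/
noncomputable def seqComp (𝒜 : OMDP S₁ A₁) (ℬ : OMDP S₂ A₂)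
    (h₁ : 𝒜.Or.length = ℬ.Ir.length) (h₂ : ℬ.Ol.length = 𝒜.Il.length) :
    OMDP (S₁ ⊕ S₂) (A₁ ⊕ A₂) where
  M := ⟨fun t a =>
    match t with
    | Sum.inl s =>
        if h : ∃ k : Fin 𝒜.Or.length, 𝒜.Or.get k = s then
          some fun t' => if t' = Sum.inr (ℬ.Ir.get (Fin.cast h₁ h.choose)) then 1 else 0
        else
          match a with
          | Sum.inl a => (𝒜.M.P s a).map fun d => Sum.elim d fun _ => 0
          | Sum.inr _ => none
    | Sum.inr s =>
        if h : ∃ k : Fin ℬ.Ol.length, ℬ.Ol.get k = s then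
          some fun t' => if t' = Sum.inl (𝒜.Il.get (Fin.cast h₂ h.choose)) then 1 else 0
        else
          match a with
          | Sum.inr a => (ℬ.M.P s a).map fun d => Sum.elim (fun _ => 0) d
          | Sum.inl _ => none⟩
  Ir := 𝒜.Ir.map Sum.inl
  Il := ℬ.Il.map Sum.inr
  Or := ℬ.Or.map Sum.inr
  Ol := 𝒜.Ol.map Sum.inl

/-- The sequential composition `σ₁ ⨟ σ₂` of memoryless schedulers on `𝒜` and `ℬ`:
it behaves like `σ₁` on the states of `𝒜` and like `σ₂` on the states of `ℬ`
(on the connecting exits, where all actions induce the same probability-1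
transition, it plays uniformly). -/
noncomputable def schedSeqComp [Fintype A₁] [Fintype A₂] (𝒜 : OMDP S₁ A₁) (ℬ : OMDP S₂ A₂)
    (σ₁ : Sched S₁ A₁) (σ₂ : Sched S₂ A₂) : Sched (S₁ ⊕ S₂) (A₁ ⊕ A₂) := fun π a =>
  match π.last, a with
  | Sum.inl s, a =>
      if s ∈ 𝒜.Or then ((Fintype.card (A₁ ⊕ A₂) : ℝ))⁻¹
      else
        match a with
        | Sum.inl a => σ₁ ⟨s, []⟩ a
        | Sum.inr _ => 0
  | Sum.inr s, a =>
      if s ∈ ℬ.Ol then ((Fintype.card (A₁ ⊕ A₂) : ℝ))⁻¹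
      else
        match a with
        | Sum.inr a => σ₂ ⟨s, []⟩ a
        | Sum.inl _ => 0

/-- The restriction of a (memoryless) scheduler on `𝒜 ⨟ ℬ` to the states of `𝒜`. -/
noncomputable def restrictL [Fintype S₁] [Fintype A₁] (𝒜 : OMDP S₁ A₁)
    (τ : Sched (S₁ ⊕ S₂) (A₁ ⊕ A₂)) : Sched S₁ A₁ := fun π a =>
  if 𝒜.M.terminal π.last then 0 else τ ⟨Sum.inl π.last, []⟩ (Sum.inl a)

/-- The restriction of a (memoryless) scheduler on `𝒜 ⨟ ℬ` to the states of `ℬ`. -/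
noncomputable def restrictR [Fintype S₂] [Fintype A₂] (ℬ : OMDP S₂ A₂)
    (τ : Sched (S₁ ⊕ S₂) (A₁ ⊕ A₂)) : Sched S₂ A₂ := fun π a =>
  if ℬ.M.terminal π.last then 0 else τ ⟨Sum.inr π.last, []⟩ (Sum.inr a)

end OMDP

end SD

namespace SD

/-- The `L∞`-error `gap_∞(L,U)` between two families of subsets of `ℝ^ι`:
the sup over the family index and over points of the larger sets of the
distance (in the supremum norm, as an extended real) to the smaller sets. -/
noncomputable def gapInf {κ ι : Type} (L U : κ → Set (ι → ℝ)) : ℝ≥0∞ :=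
  ⨆ k : κ, ⨆ p ∈ U k, ⨅ q ∈ L k, ⨆ i : ι, edist (p i) (q i)

end SD

namespace SD

theorem FinPath.last_snoc {S A : Type} (π : FinPath S A) (a : A) (s : S) :
    (π.snoc a s).last = s := by
  simp [FinPath.last, FinPath.snoc, List.getLastD_eq_getLast?]

namespace MDP

variable {S A : Type}

theorem prob_of_eq_some {M : MDP S A} {s : S} {a : A} {d : S → ℝ} (h : M.P s a = some d)
    (s' : S) : M.prob s a s' = d s' := by
  simp [prob, h]

theorem prob_of_eq_none {M : MDP S A} {s : S} {a : A} (h : M.P s a = none) (s' : S) :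
    M.prob s a s' = 0 := by
  simp [prob, h]

theorem consistentFrom_append (M : MDP S A) (a : A) (t : S) (l : List (A × S)) (s : S) :
    M.ConsistentFrom s (l ++ [(a, t)]) ↔
      M.ConsistentFrom s l ∧ M.prob ((l.map Prod.snd).getLastD s) a t ≠ 0 := by
  induction l generalizing s with
  | nil => simp [ConsistentFrom]
  | cons x l ih =>
    obtain ⟨b, u⟩ := x
    simp only [List.cons_append, ConsistentFrom, ih, List.map_cons, List.getLastD_cons, and_assoc]

theorem consistent_snoc (M : MDP S A) (π : FinPath S A) (a : A) (t : S) :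
    M.Consistent (π.snoc a t) ↔ M.Consistent π ∧ M.prob π.last a t ≠ 0 :=
  M.consistentFrom_append a t π.steps π.start

theorem consistent_nil (M : MDP S A) (s : S) : M.Consistent ⟨s, []⟩ := trivial

variable [Fintype S] [Fintype A]

theorem Proper.prob_nonneg {M : MDP S A} (hM : M.Proper) (s : S) (a : A) (s' : S) :
    0 ≤ M.prob s a s' := by
  cases h : M.P s a with
  | none => rw [prob_of_eq_none h]
  | some d => rw [prob_of_eq_some h]; exact (hM s a d h).1 s'

theorem Proper.sum_prob_le_one {M : MDP S A} (hM : M.Proper) (s : S) (a : A) :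
    ∑ s', M.prob s a s' ≤ 1 := by
  cases h : M.P s a with
  | none => simp [prob_of_eq_none h]
  | some d => simp only [prob_of_eq_some h]; exact (hM s a d h).2.le

theorem IsSched.sum_le_one {M : MDP S A} {σ : Sched S A} (hσ : M.IsSched σ)
    {π : FinPath S A} (hπ : M.Consistent π) : ∑ a, σ π a ≤ 1 := by
  obtain ⟨-, h₂, h₃⟩ := hσ π hπ
  by_cases ht : M.terminal π.last
  · have : ∀ a, σ π a = 0 := fun a => by
      by_contra h
      exact h₂ a h (ht a)
    simp [this]
  · exact (h₃ ht).le

theorem reachN_le_one {M : MDP S A} (hM : M.Proper) {σ : Sched S A} (hσ : M.IsSched σ)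
    (T : Set S) (n : ℕ) {π : FinPath S A} (hπ : M.Consistent π) : M.reachN σ T n π ≤ 1 := by
  induction n generalizing π with
  | zero => unfold reachN; split_ifs <;> norm_num
  | succ n ih =>
    unfold reachN
    split_ifs
    · exact le_rfl
    refine le_trans (Finset.sum_le_sum fun a _ => ?_) (hσ.sum_le_one hπ)
    refine mul_le_of_le_one_right ((hσ π hπ).1 a) ?_
    refine le_trans (Finset.sum_le_sum fun s' _ => ?_) (hM.sum_prob_le_one π.last a)
    by_cases h0 : M.prob π.last a s' = 0
    · simp [h0]
    · exact mul_le_of_le_one_right (hM.prob_nonneg _ _ _)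
        (ih ((M.consistent_snoc π a s').2 ⟨hπ, h0⟩))

theorem reachN_le_Pr {M : MDP S A} (hM : M.Proper) {σ : Sched S A} (hσ : M.IsSched σ)
    (T : Set S) (n : ℕ) (s : S) : M.reachN σ T n ⟨s, []⟩ ≤ M.Pr σ s T := by
  refine le_ciSup (f := fun n => M.reachN σ T n ⟨s, []⟩) ⟨1, ?_⟩ n
  rintro _ ⟨n, rfl⟩
  exact reachN_le_one hM hσ T n (M.consistent_nil s)

theorem Pr_nonneg {M : MDP S A} (hM : M.Proper) {σ : Sched S A} (hσ : M.IsSched σ)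
    (T : Set S) (s : S) : 0 ≤ M.Pr σ s T := by
  refine le_trans ?_ (reachN_le_Pr hM hσ T 0 s)
  unfold reachN
  split_ifs <;> norm_num

/-- `w` is a distribution over the actions enabled in `s` (or zero if there are none). -/
def IsChoice (M : MDP S A) (s : S) (w : A → ℝ) : Prop :=
  (∀ a, 0 ≤ w a) ∧ (∀ a, w a ≠ 0 → M.enabled s a) ∧ (¬M.terminal s → ∑ a, w a = 1)

theorem exists_isChoice (M : MDP S A) (s : S) : ∃ w, M.IsChoice s w := by
  by_cases ht : M.terminal s
  · exact ⟨0, by simp, by simp, fun h => absurd ht h⟩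
  · obtain ⟨a, ha⟩ := not_forall.1 ht
    refine ⟨Pi.single a 1, fun b => ?_, fun b hb => ?_, fun _ => by simp⟩
    · by_cases h : b = a
      · subst h; simp
      · simp [h]
    · by_cases h : b = a
      · subst h; exact ha
      · simp [h] at hb

theorem isSched_of_isChoice {M : MDP S A} {f : S → A → ℝ} (hf : ∀ s, M.IsChoice s (f s)) :
    M.IsSched fun π => f π.last := fun π _ => hf π.last

theorem exists_isSched (M : MDP S A) : ∃ σ, M.IsSched σ := by
  choose f hf using M.exists_isChoice
  exact ⟨_, isSched_of_isChoice hf⟩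

theorem reachN_of_terminal {M : MDP S A} {σ : Sched S A} {T : Set S} {π : FinPath S A}
    (ht : M.terminal π.last) (hT : π.last ∉ T) (n : ℕ) : M.reachN σ T n π = 0 := by
  cases n with
  | zero => simp [reachN, hT]
  | succ n => simp [reachN, hT, prob_of_eq_none (ht _)]

theorem reachN_of_mem {M : MDP S A} {σ : Sched S A} {T : Set S} {π : FinPath S A}
    (hT : π.last ∈ T) (n : ℕ) : M.reachN σ T n π = 1 := by
  cases n <;> simp [reachN, hT]

end MDP

namespace OMDP

theorem achievable_nonempty {S A : Type} [Fintype S] [Fintype A] (𝒜 : OMDP S A) (i : S) :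
    (𝒜.achievable i).Nonempty :=
  let ⟨σ, hσ⟩ := 𝒜.M.exists_isSched
  ⟨_, σ, hσ, le_rfl⟩

section Shortcut

variable {S A : Type} [Fintype S] [Fintype A] (𝒜 : OMDP S A)
  (B : 𝒜.EntrIdx → Finset (𝒜.ExitIdx → ℝ))

theorem mem_convexHull_iff_weights (k : 𝒜.EntrIdx) (x : 𝒜.ExitIdx → ℝ) :
    x ∈ convexHull ℝ (B k : Set (𝒜.ExitIdx → ℝ)) ↔
      ∃ w : ShortAct 𝒜 B → ℝ, (∀ a, 0 ≤ w a) ∧ (∀ a, w a ≠ 0 → a.1 ∈ B k) ∧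
        ∑ a, w a = 1 ∧ ∑ a, w a • a.1 = x := by
  constructor
  · intro hx
    obtain ⟨w, hw0, hw1, hwx⟩ := Finset.mem_convexHull'.1 hx
    have key : ∀ {V : Type} [AddCommMonoid V] (g : (𝒜.ExitIdx → ℝ) → V),
        ∑ a : ShortAct 𝒜 B, (if a.1 ∈ B k then g a.1 else 0) = ∑ y ∈ B k, g y := by
      intro V _ g
      rw [← Finset.sum_filter]
      refine Finset.sum_bij (fun a _ => a.1) (by simp) (fun a _ b _ h => Subtype.ext h)
        (fun y hy => ⟨⟨y, k, hy⟩, by simpa using hy, rfl⟩) (fun _ _ => rfl)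
    refine ⟨fun a => if a.1 ∈ B k then w a.1 else 0, fun a => ?_, fun a ha => ?_, ?_, ?_⟩
    · dsimp only
      split_ifs with h
      exacts [hw0 _ h, le_rfl]
    · by_contra h
      simp [h] at ha
    · rw [key, hw1]
    · rw [← hwx, ← key]
      exact Finset.sum_congr rfl fun a _ => by by_cases h : a.1 ∈ B k <;> simp [h]
  · rintro ⟨w, hw0, hwB, hw1, rfl⟩
    rw [← Finset.sum_filter_of_ne (p := fun a => w a ≠ 0) (fun a _ h h' => h (by simp [h']))]
    refine (convex_convexHull ℝ _).sum_mem (fun a _ => hw0 a) ?_ fun a ha => ?_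
    · rw [Finset.sum_filter_ne_zero, hw1]
    · exact subset_convexHull ℝ _ (hwB a (Finset.mem_filter.1 ha).2)

theorem subdist_of_mem_convexHull {ι : Type} [Fintype ι] {s : Set (ι → ℝ)}
    (hs : ∀ p ∈ s, Subdist p) {p : ι → ℝ} (hp : p ∈ convexHull ℝ s) : Subdist p := by
  have hc : Convex ℝ {p : ι → ℝ | Subdist p} := by
    rintro p ⟨hp0, hp1⟩ q ⟨hq0, hq1⟩ a b ha hb hab
    refine ⟨fun j => ?_, ?_⟩
    · have := hp0 j
      have := hq0 j
      simp only [Pi.add_apply, Pi.smul_apply, smul_eq_mul]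
      positivity
    · simp only [Pi.add_apply, Pi.smul_apply, smul_eq_mul, Finset.sum_add_distrib,
        ← Finset.mul_sum]
      nlinarith
  exact convexHull_min hs hc hp

theorem sum_option_mul_shortcut (a : 𝒜.ExitIdx → ℝ) (g : S → ℝ) :
    ∑ s', (∑ j : 𝒜.ExitIdx, if j.1 = s' then a j else 0) * g s' = ∑ j, a j * g j.1 := by
  simp only [Finset.sum_mul]
  rw [Finset.sum_comm]
  refine Finset.sum_congr rfl fun j _ => ?_
  simp [ite_mul]

theorem sum_option_shortcut (a : 𝒜.ExitIdx → ℝ) :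
    ∑ s', (∑ j : 𝒜.ExitIdx, if j.1 = s' then a j else 0) = ∑ j, a j := by
  simpa using 𝒜.sum_option_mul_shortcut a fun _ => 1

theorem shortcut_proper (hB : ∀ k, ∀ p ∈ B k, Subdist p) : (𝒜.shortcut B).M.Proper := by
  rintro (_ | s) a d hd
  · simp [shortcut] at hd
  · simp only [shortcut] at hd
    split_ifs at hd with h
    obtain ⟨hs, ha⟩ := h
    obtain ⟨h0, h1⟩ := hB _ _ ha
    cases hd
    refine ⟨?_, ?_⟩
    · rintro (_ | s')
      · exact sub_nonneg.2 h1
      · exact Finset.sum_nonneg fun j _ => by split_ifs; exacts [h0 j, le_rfl]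
    · rw [Fintype.sum_option, 𝒜.sum_option_shortcut]
      ring

end Shortcut

section SeqComp

variable {S₁ A₁ S₂ A₂ : Type} [Fintype S₁] [Fintype A₁] [Fintype S₂] [Fintype A₂]

theorem seqComp_proper {𝒜 : OMDP S₁ A₁} {ℬ : OMDP S₂ A₂} (hA : 𝒜.M.Proper) (hB : ℬ.M.Proper)
    (h₁ : 𝒜.Or.length = ℬ.Ir.length) (h₂ : ℬ.Ol.length = 𝒜.Il.length) :
    (𝒜.seqComp ℬ h₁ h₂).M.Proper := by
  rintro (s | s) a d hd
  · simp only [seqComp] at hd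
    split_ifs at hd with h
    · cases hd
      refine ⟨fun t => by dsimp only; split_ifs <;> norm_num, by simp⟩
    · rcases a with a | a
      · simp only [Option.map_eq_some_iff] at hd
        obtain ⟨d', hd', rfl⟩ := hd
        refine ⟨?_, ?_⟩
        · rintro (t | t)
          exacts [(hA s a d' hd').1 t, le_rfl]
        · simpa [Fintype.sum_sum_type] using (hA s a d' hd').2
      · simp at hd
  · simp only [seqComp] at hd
    split_ifs at hd with h
    · cases hd
      refine ⟨fun t => by dsimp only; split_ifs <;> norm_num, by simp⟩
    · rcases a with a | a
      · simp at hd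
      · simp only [Option.map_eq_some_iff] at hd
        obtain ⟨d', hd', rfl⟩ := hd
        refine ⟨?_, ?_⟩
        · rintro (t | t)
          exacts [le_rfl, (hB s a d' hd').1 t]
        · simpa [Fintype.sum_sum_type] using (hB s a d' hd').2

end SeqComp

end OMDP

end SD

namespace SD

namespace OMDP

section ShortcutComp

variable {S₁ A₁ S₂ A₂ : Type} [Fintype S₁] [Fintype A₁] [Fintype S₂] [Fintype A₂]

/-- The entrance of `ℬ` to which an exit of `𝒜` is connected in `𝒜 ⨟ ℬ`. -/
noncomputable def link (𝒜 : OMDP S₁ A₁) (ℬ : OMDP S₂ A₂) (h₁ : 𝒜.Or.length = ℬ.Ir.length)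
    {e : S₁} (he : e ∈ 𝒜.Or) : S₂ :=
  ℬ.Ir.get (Fin.cast h₁ (List.mem_iff_get.1 he).choose)

variable {𝒜 : OMDP S₁ A₁} {ℬ : OMDP S₂ A₂} {h₁ : 𝒜.Or.length = ℬ.Ir.length}

theorem link_mem {e : S₁} (he : e ∈ 𝒜.Or) : link 𝒜 ℬ h₁ he ∈ ℬ.Ir := List.get_mem _ _

theorem link_injective (hnd : ℬ.Ir.Nodup) {e e' : S₁} (he : e ∈ 𝒜.Or) (he' : e' ∈ 𝒜.Or)
    (h : link 𝒜 ℬ h₁ he = link 𝒜 ℬ h₁ he') : e = e' := by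
  have hk := (List.nodup_iff_injective_get.1 hnd) h
  have hk' : (List.mem_iff_get.1 he).choose = (List.mem_iff_get.1 he').choose := by
    simpa using hk
  rw [← (List.mem_iff_get.1 he).choose_spec, ← (List.mem_iff_get.1 he').choose_spec, hk']

variable {VA : 𝒜.EntrIdx → Finset (𝒜.ExitIdx → ℝ)} {VB : ℬ.EntrIdx → Finset (ℬ.ExitIdx → ℝ)}
  {g₁ : (𝒜.shortcut VA).Or.length = (ℬ.shortcut VB).Ir.length}
  {g₂ : (ℬ.shortcut VB).Ol.length = (𝒜.shortcut VA).Il.length}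

local notation "𝒞" => OMDP.M (seqComp (shortcut 𝒜 VA) (shortcut ℬ VB) g₁ g₂)

theorem exists_get_shortcut_Or_iff (t : Option S₁) :
    (∃ k : Fin (𝒜.shortcut VA).Or.length, (𝒜.shortcut VA).Or.get k = t) ↔
      ∃ s ∈ 𝒜.Or, some s = t := by
  rw [← List.mem_iff_get]
  simp [shortcut]

theorem exists_get_shortcut_Ol_iff (t : Option S₂) :
    (∃ k : Fin (ℬ.shortcut VB).Ol.length, (ℬ.shortcut VB).Ol.get k = t) ↔
      ∃ s ∈ ℬ.Ol, some s = t := by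
  rw [← List.mem_iff_get]
  simp [shortcut]

theorem comp_P_entr {i : S₁} (hi : i ∈ 𝒜.entr) (hi' : i ∉ 𝒜.Or) {a : ShortAct 𝒜 VA}
    (ha : a.1 ∈ VA ⟨i, hi⟩) :
    (𝒞).P (Sum.inl (some i)) (Sum.inl a) = some (Sum.elim
      (fun t => t.elim (1 - ∑ j, a.1 j) fun s => ∑ j, if j.1 = s then a.1 j else 0)
      fun _ => 0) := by
  simp only [seqComp]
  rw [dif_neg (by rw [exists_get_shortcut_Or_iff]; simpa using hi')]
  simp only [shortcut]
  rw [dif_pos ⟨hi, ha⟩]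
  simp only [Option.map_some, Option.some.injEq]
  funext t
  rcases t with (_ | t) | t <;> rfl

theorem comp_P_linked (hnd : 𝒜.Or.Nodup) {e : S₁} (he : e ∈ 𝒜.Or)
    (c : ShortAct 𝒜 VA ⊕ ShortAct ℬ VB) :
    (𝒞).P (Sum.inl (some e)) c = some fun t =>
      if t = Sum.inr (some (link 𝒜 ℬ h₁ he)) then 1 else 0 := by
  have h : ∃ k : Fin (𝒜.shortcut VA).Or.length, (𝒜.shortcut VA).Or.get k = some e := by
    rw [exists_get_shortcut_Or_iff]; exact ⟨e, he, rfl⟩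
  simp only [seqComp]
  rw [dif_pos h]
  have hl : (ℬ.shortcut VB).Ir.get (Fin.cast g₁ h.choose) = some (link 𝒜 ℬ h₁ he) := by
    have hs := h.choose_spec
    have hs' := (List.mem_iff_get.1 he).choose_spec
    generalize h.choose = k at hs ⊢
    unfold link
    generalize (List.mem_iff_get.1 he).choose = k' at hs' ⊢
    obtain ⟨k, hlt⟩ := k
    have hk : k = k'.1 := by
      have hs₂ : (𝒜.Or.map some)[k]'(by simpa [shortcut] using hlt) = some e := hs
      rw [List.getElem_map, Option.some.injEq] at hs₂
      exact (hnd.getElem_inj_iff).1 (hs₂.trans hs'.symm)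
    change (ℬ.Ir.map some)[k]'(g₁ ▸ hlt) = _
    simp [hk]
  rw [hl]
  congr! 3

theorem comp_P_entr_right (hOl : ℬ.Ol = []) {i : S₂} (hi : i ∈ ℬ.entr) {b : ShortAct ℬ VB}
    (hb : b.1 ∈ VB ⟨i, hi⟩) :
    (𝒞).P (Sum.inr (some i)) (Sum.inr b) = some (Sum.elim (fun _ => 0)
      (fun t => t.elim (1 - ∑ j, b.1 j) fun s => ∑ j, if j.1 = s then b.1 j else 0)) := by
  simp only [seqComp]
  rw [dif_neg (by rw [exists_get_shortcut_Ol_iff]; simp [hOl])]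
  simp only [shortcut]
  rw [dif_pos ⟨hi, hb⟩]
  simp only [Option.map_some, Option.some.injEq]
  funext t
  rcases t with t | (_ | t) <;> rfl

theorem comp_enabled_entr {i : S₁} (hi : i ∈ 𝒜.entr) (hi' : i ∉ 𝒜.Or)
    {c : ShortAct 𝒜 VA ⊕ ShortAct ℬ VB} :
    (𝒞).enabled (Sum.inl (some i)) c ↔ ∃ a, c = Sum.inl a ∧ a.1 ∈ VA ⟨i, hi⟩ := by
  constructor
  · intro hc
    simp only [MDP.enabled, seqComp] at hc
    rw [dif_neg (by rw [exists_get_shortcut_Or_iff]; simpa using hi')] at hc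
    rcases c with a | b
    · refine ⟨a, rfl, ?_⟩
      by_contra hna
      refine hc ?_
      simp only [shortcut]
      rw [dif_neg fun ⟨_, h⟩ => hna h]
      rfl
    · exact absurd rfl hc
  · rintro ⟨a, rfl, ha⟩
    rw [MDP.enabled, comp_P_entr hi hi' ha]
    simp

theorem comp_enabled_entr_right (hOl : ℬ.Ol = []) {i : S₂} (hi : i ∈ ℬ.entr)
    {c : ShortAct 𝒜 VA ⊕ ShortAct ℬ VB} :
    (𝒞).enabled (Sum.inr (some i)) c ↔ ∃ b, c = Sum.inr b ∧ b.1 ∈ VB ⟨i, hi⟩ := by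
  constructor
  · intro hc
    simp only [MDP.enabled, seqComp] at hc
    rw [dif_neg (by rw [exists_get_shortcut_Ol_iff]; simp [hOl])] at hc
    rcases c with a | b
    · exact absurd rfl hc
    · refine ⟨b, rfl, ?_⟩
      by_contra hnb
      refine hc ?_
      simp only [shortcut]
      rw [dif_neg fun ⟨_, h⟩ => hnb h]
      rfl
  · rintro ⟨b, rfl, hb⟩
    rw [MDP.enabled, comp_P_entr_right hOl hi hb]
    simp

theorem comp_terminal_sink_left : (𝒞).terminal (Sum.inl none) := by
  intro c
  simp only [seqComp]
  rw [dif_neg (by rw [exists_get_shortcut_Or_iff]; simp)]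
  rcases c with a | b <;> rfl

theorem comp_terminal_right (hOl : ℬ.Ol = []) {t : Option S₂} (ht : ∀ s ∈ t, s ∉ ℬ.entr) :
    (𝒞).terminal (Sum.inr t) := by
  intro c
  simp only [seqComp]
  rw [dif_neg (by rw [exists_get_shortcut_Ol_iff]; simp [hOl])]
  rcases c with a | b
  · rfl
  · rcases t with _ | s
    · rfl
    · simp only [shortcut]
      rw [dif_neg fun ⟨h, _⟩ => ht s rfl h]
      rfl

variable {σ : Sched (Option S₁ ⊕ Option S₂) (ShortAct 𝒜 VA ⊕ ShortAct ℬ VB)}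
  {π : FinPath (Option S₁ ⊕ Option S₂) (ShortAct 𝒜 VA ⊕ ShortAct ℬ VB)}

theorem comp_reachN_zero {o : S₂} (hπ : π.last ≠ Sum.inr (some o)) :
    (𝒞).reachN σ {Sum.inr (some o)} 0 π = 0 := by
  simp [MDP.reachN, hπ]

theorem comp_reachN_entr {i : S₁} (hi : i ∈ 𝒜.entr) (hi' : i ∉ 𝒜.Or) (o : S₂)
    (hπ : π.last = Sum.inl (some i)) (hσ : ∀ c, σ π c ≠ 0 → (𝒞).enabled π.last c) (n : ℕ) :
    (𝒞).reachN σ {Sum.inr (some o)} (n + 1) π =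
      ∑ a, σ π (Sum.inl a) * ∑ e, a.1 e *
        (𝒞).reachN σ {Sum.inr (some o)} n (π.snoc (Sum.inl a) (Sum.inl (some e.1))) := by
  rw [MDP.reachN, if_neg (by simp [hπ]), Fintype.sum_sum_type]
  rw [hπ] at hσ ⊢
  have hr : ∀ b, σ π (Sum.inr b) = 0 := fun b => by
    by_contra h
    simpa using (comp_enabled_entr hi hi').1 (hσ _ h)
  simp only [hr, zero_mul, Finset.sum_const_zero, add_zero]
  refine Finset.sum_congr rfl fun a _ => ?_
  by_cases h0 : σ π (Sum.inl a) = 0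
  · simp [h0]
  have ha : a.1 ∈ VA ⟨i, hi⟩ := by simpa using (comp_enabled_entr hi hi').1 (hσ _ h0)
  congr 1
  simp only [MDP.prob_of_eq_some (comp_P_entr hi hi' ha), Fintype.sum_sum_type,
    Fintype.sum_option, Sum.elim_inl, Sum.elim_inr, Option.elim_none, Option.elim_some, zero_mul,
    Finset.sum_const_zero, add_zero]
  rw [MDP.reachN_of_terminal (by rw [FinPath.last_snoc]; exact comp_terminal_sink_left)
    (by simp [FinPath.last_snoc]), mul_zero, zero_add, sum_option_mul_shortcut]

theorem comp_reachN_linked (hnd : 𝒜.Or.Nodup) {e : S₁} (he : e ∈ 𝒜.Or) (o : S₂)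
    (hπ : π.last = Sum.inl (some e)) (n : ℕ) :
    (𝒞).reachN σ {Sum.inr (some o)} (n + 1) π =
      ∑ c, σ π c * (𝒞).reachN σ {Sum.inr (some o)} n
        (π.snoc c (Sum.inr (some (link 𝒜 ℬ h₁ he)))) := by
  rw [MDP.reachN, if_neg (by simp [hπ]), hπ]
  refine Finset.sum_congr rfl fun c _ => ?_
  congr 1
  simp [MDP.prob_of_eq_some (comp_P_linked (h₁ := h₁) hnd he c)]

theorem comp_reachN_entr_right (hOl : ℬ.Ol = []) (hdisj : ∀ s ∈ ℬ.exit, s ∉ ℬ.entr)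
    {i : S₂} (hi : i ∈ ℬ.entr) (o : ℬ.ExitIdx)
    (hπ : π.last = Sum.inr (some i)) (hσ : ∀ c, σ π c ≠ 0 → (𝒞).enabled π.last c) (n : ℕ) :
    (𝒞).reachN σ {Sum.inr (some o.1)} (n + 1) π = ∑ b, σ π (Sum.inr b) * b.1 o := by
  have hio : i ≠ o.1 := fun h => hdisj o.1 o.2 (h ▸ hi)
  rw [MDP.reachN, if_neg (by simp [hπ, hio]), Fintype.sum_sum_type]
  rw [hπ] at hσ ⊢
  have hr : ∀ a, σ π (Sum.inl a) = 0 := fun a => by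
    by_contra h
    simpa using (comp_enabled_entr_right hOl hi).1 (hσ _ h)
  simp only [hr, zero_mul, Finset.sum_const_zero, zero_add]
  refine Finset.sum_congr rfl fun b _ => ?_
  by_cases h0 : σ π (Sum.inr b) = 0
  · simp [h0]
  have hb : b.1 ∈ VB ⟨i, hi⟩ := by simpa using (comp_enabled_entr_right hOl hi).1 (hσ _ h0)
  congr 1
  simp only [MDP.prob_of_eq_some (comp_P_entr_right hOl hi hb), Fintype.sum_sum_type,
    Fintype.sum_option, Sum.elim_inl, Sum.elim_inr, Option.elim_none, Option.elim_some, zero_mul,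
    Finset.sum_const_zero, zero_add]
  rw [MDP.reachN_of_terminal (by
    rw [FinPath.last_snoc]; exact comp_terminal_right hOl (by simp)) (by simp [FinPath.last_snoc]),
    mul_zero, zero_add, sum_option_mul_shortcut, Finset.sum_eq_single o]
  · rw [MDP.reachN_of_mem (by simp [FinPath.last_snoc]), mul_one]
  · intro j _ hj
    rw [MDP.reachN_of_terminal, mul_zero]
    · rw [FinPath.last_snoc]
      exact comp_terminal_right hOl (by rintro s ⟨⟩; exact hdisj j.1 j.2)
    · simpa [FinPath.last_snoc, Subtype.ext_iff] using hj
  · simp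

end ShortcutComp

end OMDP

end SD

namespace SD

namespace OMDP

section ShortcutCompAchievable

variable {S₁ A₁ S₂ A₂ : Type} [Fintype S₁] [Fintype A₁] [Fintype S₂] [Fintype A₂]
  {𝒜 : OMDP S₁ A₁} {ℬ : OMDP S₂ A₂} {h₁ : 𝒜.Or.length = ℬ.Ir.length}
  {VA : 𝒜.EntrIdx → Finset (𝒜.ExitIdx → ℝ)} {VB : ℬ.EntrIdx → Finset (ℬ.ExitIdx → ℝ)}
  {g₁ : (𝒜.shortcut VA).Or.length = (ℬ.shortcut VB).Ir.length}
  {g₂ : (ℬ.shortcut VB).Ol.length = (𝒜.shortcut VA).Il.length}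

local notation "𝒞" => OMDP.M (seqComp (shortcut 𝒜 VA) (shortcut ℬ VB) g₁ g₂)

theorem comp_proper (hVA : ∀ k, ∀ p ∈ VA k, Subdist p) (hVB : ∀ k, ∀ p ∈ VB k, Subdist p) :
    (𝒞).Proper :=
  seqComp_proper (𝒜.shortcut_proper VA hVA) (ℬ.shortcut_proper VB hVB) g₁ g₂

theorem isChoice_mem_convexHull {i : S₁} (hi : i ∈ 𝒜.entr) (hi' : i ∉ 𝒜.Or)
    (hne : (VA ⟨i, hi⟩).Nonempty) {w : ShortAct 𝒜 VA ⊕ ShortAct ℬ VB → ℝ}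
    (hw : (𝒞).IsChoice (Sum.inl (some i)) w) :
    ∑ a, w (Sum.inl a) • a.1 ∈ convexHull ℝ (VA ⟨i, hi⟩ : Set (𝒜.ExitIdx → ℝ)) := by
  obtain ⟨h0, hen, h1⟩ := hw
  refine (mem_convexHull_iff_weights 𝒜 VA _ _).2 ⟨fun a => w (Sum.inl a), fun a => h0 _,
    fun a ha => by simpa using (comp_enabled_entr hi hi').1 (hen _ ha), ?_, rfl⟩
  obtain ⟨p, hp⟩ := hne
  rw [← h1 fun ht => (comp_enabled_entr hi hi').2 ⟨⟨p, _, hp⟩, rfl, hp⟩ (ht _),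
    Fintype.sum_sum_type, left_eq_add]
  refine Finset.sum_eq_zero fun b _ => ?_
  by_contra h
  simpa using (comp_enabled_entr hi hi').1 (hen _ h)

theorem isChoice_mem_convexHull_right (hOl : ℬ.Ol = []) (k : ℬ.EntrIdx)
    (hne : (VB k).Nonempty) {w : ShortAct 𝒜 VA ⊕ ShortAct ℬ VB → ℝ}
    (hw : (𝒞).IsChoice (Sum.inr (some k.1)) w) :
    ∑ b, w (Sum.inr b) • b.1 ∈ convexHull ℝ (VB k : Set (ℬ.ExitIdx → ℝ)) := by
  obtain ⟨h0, hen, h1⟩ := hw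
  refine (mem_convexHull_iff_weights ℬ VB _ _).2 ⟨fun b => w (Sum.inr b), fun b => h0 _,
    fun b hb => by simpa using (comp_enabled_entr_right hOl k.2).1 (hen _ hb), ?_, rfl⟩
  obtain ⟨p, hp⟩ := hne
  rw [← h1 fun ht => (comp_enabled_entr_right hOl k.2).2 ⟨⟨p, _, hp⟩, rfl, hp⟩ (ht _),
    Fintype.sum_sum_type, right_eq_add]
  refine Finset.sum_eq_zero fun a _ => ?_
  by_contra h
  simpa using (comp_enabled_entr_right hOl k.2).1 (hen _ h)

/-- Normalizing a mixture of vectors depending on two indices: a family `q a e` weighted by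
`w a * y a e` can be replaced by one vector per `e`, weighted by the mixture of the `y a e`. -/
theorem exists_mixture {α ε E : Type} [Fintype α] [Fintype ε] [AddCommGroup E] [Module ℝ E]
    {w : α → ℝ} {y : α → ε → ℝ} (hwy : ∀ a e, 0 ≤ w a * y a e) {K : ε → Set E}
    (hK : ∀ e, Convex ℝ (K e)) (hne : ∀ e, (K e).Nonempty) {Q : α → ε → E}
    (hQ : ∀ a e, w a * y a e ≠ 0 → Q a e ∈ K e) :
    ∃ q : ε → E, (∀ e, q e ∈ K e) ∧
      ∀ e, (∑ a, w a * y a e) • q e = ∑ a, (w a * y a e) • Q a e := by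
  have h : ∀ e, ∃ q ∈ K e, (∑ a, w a * y a e) • q = ∑ a, (w a * y a e) • Q a e := by
    intro e
    by_cases hx : ∑ a, w a * y a e = 0
    · obtain ⟨q, hq⟩ := hne e
      refine ⟨q, hq, ?_⟩
      have h0 := (Finset.sum_eq_zero_iff_of_nonneg fun a _ => hwy a e).1 hx
      rw [hx, zero_smul, Finset.sum_eq_zero fun a ha => by rw [h0 a ha, zero_smul]]
    · set t := Finset.univ.filter fun a => w a * y a e ≠ 0
      have ht : ∑ a ∈ t, w a * y a e = ∑ a, w a * y a e := Finset.sum_filter_ne_zero _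
      have htQ : ∑ a ∈ t, (w a * y a e) • Q a e = ∑ a, (w a * y a e) • Q a e :=
        Finset.sum_filter_of_ne fun a _ h h' => h (by rw [h', zero_smul])
      have hpos : 0 < ∑ a ∈ t, w a * y a e :=
        ht ▸ lt_of_le_of_ne (Finset.sum_nonneg fun a _ => hwy a e) (Ne.symm hx)
      refine ⟨t.centerMass (fun a => w a * y a e) (fun a => Q a e),
        (hK e).centerMass_mem (fun a _ => hwy a e) hpos
          fun a ha => hQ a e (Finset.mem_filter.1 ha).2, ?_⟩
      rw [← ht, ← htQ, Finset.centerMass, smul_inv_smul₀ hpos.ne']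
  choose q hq hq' using h
  exact ⟨q, hq, hq'⟩

theorem exists_Pr_le_mixture (hnd : 𝒜.Or.Nodup) (hOl : ℬ.Ol = [])
    (hdisj : ∀ s ∈ ℬ.exit, s ∉ ℬ.entr) (hOr : ∀ e : 𝒜.ExitIdx, e.1 ∈ 𝒜.Or)
    {l : 𝒜.ExitIdx → ℬ.EntrIdx} (hl : ∀ e, (l e).1 = link 𝒜 ℬ h₁ (hOr e))
    (hVA : ∀ k, ∀ p ∈ VA k, Subdist p) (hVB : ∀ k, ∀ p ∈ VB k, Subdist p)
    {i : S₁} (hi : i ∈ 𝒜.entr) (hi' : i ∉ 𝒜.Or) (hneA : (VA ⟨i, hi⟩).Nonempty)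
    (hneB : ∀ k, (VB k).Nonempty)
    {σ : Sched (Option S₁ ⊕ Option S₂) (ShortAct 𝒜 VA ⊕ ShortAct ℬ VB)} (hσ : (𝒞).IsSched σ) :
    ∃ x ∈ convexHull ℝ (VA ⟨i, hi⟩ : Set (𝒜.ExitIdx → ℝ)), ∃ q : 𝒜.ExitIdx → ℬ.ExitIdx → ℝ,
      (∀ e, q e ∈ convexHull ℝ (VB (l e) : Set (ℬ.ExitIdx → ℝ))) ∧
      ∀ o : ℬ.ExitIdx,
        (𝒞).Pr σ (Sum.inl (some i)) {Sum.inr (some o.1)} ≤ ∑ e, x e * q e o := by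
  set π₀ : FinPath (Option S₁ ⊕ Option S₂) (ShortAct 𝒜 VA ⊕ ShortAct ℬ VB) :=
    ⟨Sum.inl (some i), []⟩
  have hc₀ : (𝒞).Consistent π₀ := MDP.consistent_nil _ _
  set π₁ : ShortAct 𝒜 VA → 𝒜.ExitIdx → FinPath _ _ :=
    fun a e => π₀.snoc (Sum.inl a) (Sum.inl (some e.1)) with hπ₁
  set π₂ : ShortAct 𝒜 VA → 𝒜.ExitIdx → _ → FinPath _ _ :=
    fun a e c => (π₁ a e).snoc c (Sum.inr (some (l e).1)) with hπ₂
  set w : ShortAct 𝒜 VA → ℝ := fun a => σ π₀ (Sum.inl a)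
  have hlast₁ : ∀ a e, (π₁ a e).last = Sum.inl (some e.1) := fun a e => FinPath.last_snoc _ _ _
  have hlast₂ : ∀ a e c, (π₂ a e c).last = Sum.inr (some (l e).1) :=
    fun a e c => FinPath.last_snoc _ _ _
  have hwB : ∀ a, w a ≠ 0 → a.1 ∈ VA ⟨i, hi⟩ := fun a ha => by
    simpa using (comp_enabled_entr hi hi').1 ((hσ π₀ hc₀).2.1 _ ha)
  have hc₁ : ∀ a e, w a * a.1 e ≠ 0 → (𝒞).Consistent (π₁ a e) := fun a e h => by
    refine (MDP.consistent_snoc _ _ _ _).2 ⟨hc₀, ?_⟩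
    change (𝒞).prob (Sum.inl (some i)) _ _ ≠ 0
    rw [MDP.prob_of_eq_some (comp_P_entr hi hi' (hwB a (left_ne_zero_of_mul h)))]
    simpa [← Subtype.ext_iff] using right_ne_zero_of_mul h
  have hc₂ : ∀ a e c, (𝒞).Consistent (π₁ a e) → (𝒞).Consistent (π₂ a e c) := fun a e c h => by
    refine (MDP.consistent_snoc _ _ _ _).2 ⟨h, ?_⟩
    rw [hlast₁, MDP.prob_of_eq_some (comp_P_linked (h₁ := h₁) hnd (hOr e) c), hl]
    simp
  have hwy : ∀ a e, 0 ≤ w a * a.1 e := fun a e => by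
    by_cases h : w a = 0
    · simp [h]
    · exact mul_nonneg ((hσ π₀ hc₀).1 _) ((hVA _ _ (hwB a h)).1 e)
  set Q : ShortAct 𝒜 VA → 𝒜.ExitIdx → ℬ.ExitIdx → ℝ := fun a e =>
    ∑ c, σ (π₁ a e) c • ∑ b, σ (π₂ a e c) (Sum.inr b) • b.1 with hQ_def
  have hQ : ∀ a e, w a * a.1 e ≠ 0 → Q a e ∈ convexHull ℝ (VB (l e) : Set (ℬ.ExitIdx → ℝ)) := by
    intro a e h
    have hs := hσ _ (hc₁ a e h)
    refine (convex_convexHull ℝ _).sum_mem (fun c _ => hs.1 c) (hs.2.2 fun ht => ?_)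
      fun c _ => isChoice_mem_convexHull_right (g₁ := g₁) (g₂ := g₂) hOl (l e) (hneB _) ?_
    · have := ht (Sum.inl a)
      rw [hlast₁, comp_P_linked (h₁ := h₁) hnd (hOr e)] at this
      simp at this
    · have := hσ _ (hc₂ a e c (hc₁ a e h))
      rw [hlast₂] at this
      exact this
  obtain ⟨q, hq, hqQ⟩ := exists_mixture hwy (fun e => convex_convexHull ℝ _)
    (fun e => (hneB (l e)).to_set.convexHull) hQ
  have hx : ∑ a, w a • a.1 ∈ convexHull ℝ (VA ⟨i, hi⟩ : Set (𝒜.ExitIdx → ℝ)) :=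
    isChoice_mem_convexHull hi hi' hneA (hσ π₀ hc₀)
  refine ⟨_, hx, q, hq, fun o => ?_⟩
  have hR : ∑ e, (∑ a, w a • a.1) e * q e o = ∑ a, w a * ∑ e, a.1 e * Q a e o := by
    simp only [Finset.mul_sum]
    rw [Finset.sum_comm]
    refine Finset.sum_congr rfl fun e _ => ?_
    have := congrFun (hqQ e) o
    simpa [Finset.sum_apply, mul_assoc] using this
  have hR0 : 0 ≤ ∑ e, (∑ a, w a • a.1) e * q e o := Finset.sum_nonneg fun e _ =>
    mul_nonneg ((subdist_of_mem_convexHull (hVA _) hx).1 e)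
      ((subdist_of_mem_convexHull (hVB _) (hq e)).1 o)
  refine ciSup_le fun n => ?_
  have hσ₀ := (hσ π₀ hc₀).2.1
  match n with
  | 0 => rwa [comp_reachN_zero (by simp [FinPath.last])]
  | 1 =>
    rw [comp_reachN_entr hi hi' o.1 rfl hσ₀]
    refine le_of_eq_of_le (Finset.sum_eq_zero fun a _ => ?_) hR0
    simp [comp_reachN_zero, FinPath.last_snoc]
  | 2 =>
    rw [comp_reachN_entr hi hi' o.1 rfl hσ₀]
    refine le_of_eq_of_le (Finset.sum_eq_zero fun a _ => ?_) hR0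
    refine mul_eq_zero_of_right _ (Finset.sum_eq_zero fun e _ => ?_)
    rw [comp_reachN_linked (h₁ := h₁) hnd (hOr e) o.1 (hlast₁ a e)]
    have hne : (l e).1 ≠ o.1 := fun h => hdisj o.1 o.2 (h ▸ (l e).2)
    rw [hl] at hne
    simp [comp_reachN_zero, FinPath.last_snoc, hne]
  | n + 3 =>
    rw [comp_reachN_entr hi hi' o.1 rfl hσ₀, hR]
    refine le_of_eq (Finset.sum_congr rfl fun a _ => ?_)
    rw [Finset.mul_sum, Finset.mul_sum]
    refine Finset.sum_congr rfl fun e _ => ?_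
    rw [← mul_assoc, ← mul_assoc]
    change w a * a.1 e * _ = w a * a.1 e * _
    by_cases h0 : w a * a.1 e = 0
    · simp only [h0, zero_mul]
    congr 1
    rw [comp_reachN_linked (h₁ := h₁) hnd (hOr e) o.1 (hlast₁ a e)]
    simp only [hQ_def, Finset.sum_apply, Pi.smul_apply, smul_eq_mul]
    refine Finset.sum_congr rfl fun c _ => ?_
    rw [← hl, comp_reachN_entr_right hOl hdisj (l e).2 o (hlast₂ a e c)
      (hσ _ (hc₂ a e c (hc₁ a e h0))).2.1]

theorem exists_mixture_le_Pr (hnd : 𝒜.Or.Nodup) (hOl : ℬ.Ol = [])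
    (hdisj : ∀ s ∈ ℬ.exit, s ∉ ℬ.entr) (hOr : ∀ e : 𝒜.ExitIdx, e.1 ∈ 𝒜.Or)
    {l : 𝒜.ExitIdx → ℬ.EntrIdx} (hl : ∀ e, (l e).1 = link 𝒜 ℬ h₁ (hOr e))
    (hinj : Function.Injective l)
    (hVA : ∀ k, ∀ p ∈ VA k, Subdist p) (hVB : ∀ k, ∀ p ∈ VB k, Subdist p)
    {i : S₁} (hi : i ∈ 𝒜.entr) (hi' : i ∉ 𝒜.Or)
    {x : 𝒜.ExitIdx → ℝ} (hx : x ∈ convexHull ℝ (VA ⟨i, hi⟩ : Set (𝒜.ExitIdx → ℝ)))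
    {q : 𝒜.ExitIdx → ℬ.ExitIdx → ℝ}
    (hq : ∀ e, q e ∈ convexHull ℝ (VB (l e) : Set (ℬ.ExitIdx → ℝ))) :
    ∃ σ : Sched (Option S₁ ⊕ Option S₂) (ShortAct 𝒜 VA ⊕ ShortAct ℬ VB), (𝒞).IsSched σ ∧
      ∀ o : ℬ.ExitIdx,
        ∑ e, x e * q e o ≤ (𝒞).Pr σ (Sum.inl (some i)) {Sum.inr (some o.1)} := by
  obtain ⟨w, hw0, hwB, hw1, rfl⟩ := (mem_convexHull_iff_weights 𝒜 VA _ _).1 hx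
  choose v hv0 hvB hv1 hvq using fun e => (mem_convexHull_iff_weights ℬ VB _ _).1 (hq e)
  choose d hd using (𝒞).exists_isChoice
  set f : Option S₁ ⊕ Option S₂ → ShortAct 𝒜 VA ⊕ ShortAct ℬ VB → ℝ := fun t =>
    if t = Sum.inl (some i) then Sum.elim w 0
    else if h : ∃ e, t = Sum.inr (some (l e).1) then Sum.elim (fun _ => 0) (v h.choose)
    else d t with hf_def
  have hfi : f (Sum.inl (some i)) = Sum.elim w 0 := if_pos rfl
  have hfl : ∀ e, f (Sum.inr (some (l e).1)) = Sum.elim (fun _ => 0) (v e) := fun e => by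
    have h : ∃ e', (Sum.inr (some (l e).1) : Option S₁ ⊕ Option S₂) = Sum.inr (some (l e').1) :=
      ⟨e, rfl⟩
    have he : h.choose = e := by
      have hs := h.choose_spec
      exact hinj (Subtype.ext (Option.some.inj (Sum.inr.inj hs)).symm)
    simp only [hf_def]
    rw [if_neg (by simp), dif_pos h, he]
  have hf : ∀ t, (𝒞).IsChoice t (f t) := fun t => by
    by_cases ht : t = Sum.inl (some i)
    · subst ht
      rw [hfi]
      refine ⟨?_, ?_, fun _ => by simpa [Fintype.sum_sum_type] using hw1⟩
      · rintro (a | b)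
        exacts [hw0 a, le_rfl]
      · rintro (a | b) h
        · exact (comp_enabled_entr hi hi').2 ⟨a, rfl, hwB a h⟩
        · exact absurd rfl h
    · by_cases h : ∃ e, t = Sum.inr (some (l e).1)
      · obtain ⟨e, rfl⟩ := h
        rw [hfl]
        refine ⟨?_, ?_, fun _ => by simpa [Fintype.sum_sum_type] using hv1 e⟩
        · rintro (a | b)
          exacts [le_rfl, hv0 e b]
        · rintro (a | b) h
          · exact absurd rfl h
          · exact (comp_enabled_entr_right hOl (l e).2).2 ⟨b, rfl, hvB e b h⟩
      · simp only [hf_def]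
        rw [if_neg ht, dif_neg h]
        exact hd t
  refine ⟨_, MDP.isSched_of_isChoice hf, fun o => ?_⟩
  refine le_of_eq_of_le ?_
    (MDP.reachN_le_Pr (comp_proper hVA hVB) (MDP.isSched_of_isChoice hf) _ 3 _)
  rw [comp_reachN_entr hi hi' o.1 rfl (hf _).2.1]
  have hne : ∃ a, w a ≠ 0 := by
    by_contra! h
    simp [h] at hw1
  obtain ⟨a₀, -⟩ := hne
  have hstep : ∀ (a : ShortAct 𝒜 VA) (e : 𝒜.ExitIdx),
      (𝒞).reachN (fun π => f π.last) {Sum.inr (some o.1)} 2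
        (FinPath.snoc ⟨Sum.inl (some i), []⟩ (Sum.inl a) (Sum.inl (some e.1))) = q e o := by
    intro a e
    rw [comp_reachN_linked (h₁ := h₁) hnd (hOr e) o.1 (FinPath.last_snoc _ _ _), ← hl]
    have hb : ∀ π : FinPath (Option S₁ ⊕ Option S₂) (ShortAct 𝒜 VA ⊕ ShortAct ℬ VB),
        π.last = Sum.inr (some (l e).1) →
        (𝒞).reachN (fun π => f π.last) {Sum.inr (some o.1)} 1 π = q e o := fun π hπ => by
      rw [comp_reachN_entr_right hOl hdisj (l e).2 o hπ (hf _).2.1]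
      simp only [hπ, hfl, Sum.elim_inr, ← hvq e]
      simp [Finset.sum_apply]
    simp only [hb _ (FinPath.last_snoc _ _ _), FinPath.last_snoc]
    rw [← Finset.sum_mul, (hf (Sum.inl (some e.1))).2.2 fun ht => ?_, one_mul]
    have := ht (Sum.inl a₀)
    rw [comp_P_linked (h₁ := h₁) hnd (hOr e)] at this
    simp at this
  simp only [hstep]
  change _ = ∑ a, f (Sum.inl (some i)) (Sum.inl a) * ∑ e, a.1 e * q e o
  simp only [hfi, Sum.elim_inl, Finset.sum_apply, Pi.smul_apply, smul_eq_mul, Finset.sum_mul,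
    Finset.mul_sum]
  rw [Finset.sum_comm]
  exact Finset.sum_congr rfl fun a _ => Finset.sum_congr rfl fun e _ => mul_assoc _ _ _

end ShortcutCompAchievable

end OMDP

theorem exists_of_gapInf_lt {κ ι : Type} {L U : κ → Set (ι → ℝ)} {c : ℝ≥0∞}
    (h : gapInf L U < c) {k : κ} {p : ι → ℝ} (hp : p ∈ U k) :
    ∃ q ∈ L k, ∀ i, edist (p i) (q i) < c := by
  have h₁ : ⨅ q ∈ L k, ⨆ i, edist (p i) (q i) ≤ ⨆ p ∈ U k, ⨅ q ∈ L k, ⨆ i, edist (p i) (q i) :=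
    le_iSup₂ (f := fun p (_ : p ∈ U k) => ⨅ q ∈ L k, ⨆ i, edist (p i) (q i)) p hp
  have h₂ : ⨆ p ∈ U k, ⨅ q ∈ L k, ⨆ i, edist (p i) (q i) ≤ gapInf L U :=
    le_iSup (fun k => ⨆ p ∈ U k, ⨅ q ∈ L k, ⨆ i, edist (p i) (q i)) k
  have h' := (h₁.trans h₂).trans_lt h
  simp only [iInf_lt_iff] at h'
  obtain ⟨q, hq, hlt⟩ := h'
  exact ⟨q, hq, fun i => lt_of_le_of_lt (le_iSup (fun i => edist (p i) (q i)) i) hlt⟩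

theorem exists_convexHull_of_gapInf_lt {κ ι : Type} {L U : κ → Set (ι → ℝ)} {δ : ℝ}
    (h : gapInf (fun k => dwConv (L k)) (fun k => dwConv (U k)) < ENNReal.ofReal δ)
    {k : κ} {p : ι → ℝ} (hp : p ∈ convexHull ℝ (U k)) :
    ∃ q ∈ convexHull ℝ (L k), ∀ i, p i ≤ q i + δ := by
  obtain ⟨q, ⟨q', hq', hqq'⟩, hlt⟩ :=
    exists_of_gapInf_lt h (k := k) (p := p) ⟨p, hp, le_rfl⟩
  refine ⟨q', hq', fun i => ?_⟩
  have := hlt i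
  rw [edist_dist, ENNReal.ofReal_lt_ofReal_iff_of_nonneg dist_nonneg, Real.dist_eq] at this
  have := (abs_lt.1 this).2
  have := hqq' i
  linarith

/-- The error of a mixture is bounded by the errors of its weights and of its vectors. -/
theorem mixture_le_add {ε : Type} [Fintype ε] {x x' q q' : ε → ℝ} {α β : ℝ} (hα : 0 ≤ α)
    (hβ : 0 ≤ β) (hx' : Subdist x') (hq0 : ∀ e, 0 ≤ q e) (hq1 : ∀ e, q e ≤ 1)
    (hx : ∀ e, x e ≤ x' e + α) (hq : ∀ e, q e ≤ q' e + β) :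
    ∑ e, x e * q e ≤ ∑ e, x' e * q' e + (Fintype.card ε * α + β) := by
  have h : ∀ e, x e * q e ≤ x' e * q' e + (α + x' e * β) := fun e => by
    have h1 := mul_le_mul_of_nonneg_right (hx e) (hq0 e)
    have h2 := mul_le_mul_of_nonneg_left (hq e) (hx'.1 e)
    have h3 := mul_le_mul_of_nonneg_left (hq1 e) hα
    nlinarith
  refine (Finset.sum_le_sum fun e _ => h e).trans ?_
  rw [Finset.sum_add_distrib, Finset.sum_add_distrib, ← Finset.sum_mul]
  have := mul_le_mul_of_nonneg_right hx'.2 hβ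
  simp only [Finset.sum_const, Finset.card_univ, nsmul_eq_mul]
  linarith

theorem iInf_edist_le_of_le_add {ι : Type} {L : Set (ι → ℝ)}
    (hL : ∀ v ∈ L, ∀ q ≤ v, q ∈ L) {p v : ι → ℝ} (hv : v ∈ L) {D : ℝ} (hD : 0 ≤ D)
    (h : ∀ i, p i ≤ v i + D) :
    ⨅ q ∈ L, ⨆ i, edist (p i) (q i) ≤ ENNReal.ofReal D := by
  refine iInf₂_le_of_le (p ⊓ v) (hL v hv _ inf_le_right) (iSup_le fun i => ?_)
  rw [edist_dist, Real.dist_eq]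
  refine ENNReal.ofReal_le_ofReal (abs_le.2 ⟨?_, ?_⟩)
  · have : (p ⊓ v) i ≤ p i := min_le_left _ _
    linarith
  · have : p i - D ≤ (p ⊓ v) i := le_min (by linarith) (by linarith [h i])
    linarith

end SD

open SD in
/-- Let `𝒜`, `ℬ` be rightward open MDPs with arities
`(m,0)→(l,0)` and `(l,0)→(n,0)`, and `(L^𝒜,U^𝒜)`, `(L^ℬ,U^ℬ)` sound
approximations (given by vertex families of subdistributions). Define
`L := (A^{D(L^𝒜)⨟D(L^ℬ)}(i))_{i∈I^{𝒜⨟ℬ}}` and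
`U := (A^{D(U^𝒜)⨟D(U^ℬ)}(i))_{i∈I^{𝒜⨟ℬ}}`. Then
`gap_∞(L,U) ≤ |O^𝒜| · gap_∞(L^𝒜,U^𝒜) + gap_∞(L^ℬ,U^ℬ)`. -/
theorem statement_15 {S₁ A₁ S₂ A₂ : Type}
    [Fintype S₁] [Fintype A₁] [Fintype S₂] [Fintype A₂]
    (𝒜 : OMDP S₁ A₁) (ℬ : OMDP S₂ A₂) (hWFA : 𝒜.WF) (hWFB : ℬ.WF)
    (hAIl : 𝒜.Il = []) (hAOl : 𝒜.Ol = []) (hBIl : ℬ.Il = []) (hBOl : ℬ.Ol = [])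
    (h₁ : 𝒜.Or.length = ℬ.Ir.length) (h₂ : ℬ.Ol.length = 𝒜.Il.length)
    (VLA VUA : 𝒜.EntrIdx → Finset (𝒜.ExitIdx → ℝ))
    (VLB VUB : ℬ.EntrIdx → Finset (ℬ.ExitIdx → ℝ))
    (hVLA : ∀ k, ∀ p ∈ VLA k, Subdist p) (hVUA : ∀ k, ∀ p ∈ VUA k, Subdist p)
    (hVLB : ∀ k, ∀ p ∈ VLB k, Subdist p) (hVUB : ∀ k, ∀ p ∈ VUB k, Subdist p)
    (hsoundA : ∀ k : 𝒜.EntrIdx,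
      dwConv ((VLA k : Finset (𝒜.ExitIdx → ℝ)) : Set (𝒜.ExitIdx → ℝ)) ⊆ 𝒜.achievable k.1 ∧
        𝒜.achievable k.1 ⊆ dwConv ((VUA k : Finset (𝒜.ExitIdx → ℝ)) : Set (𝒜.ExitIdx → ℝ)))
    (hsoundB : ∀ k : ℬ.EntrIdx,
      dwConv ((VLB k : Finset (ℬ.ExitIdx → ℝ)) : Set (ℬ.ExitIdx → ℝ)) ⊆ ℬ.achievable k.1 ∧
        ℬ.achievable k.1 ⊆ dwConv ((VUB k : Finset (ℬ.ExitIdx → ℝ)) : Set (ℬ.ExitIdx → ℝ)))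
    (gL₁ : (𝒜.shortcut VLA).Or.length = (ℬ.shortcut VLB).Ir.length)
    (gL₂ : (ℬ.shortcut VLB).Ol.length = (𝒜.shortcut VLA).Il.length)
    (gU₁ : (𝒜.shortcut VUA).Or.length = (ℬ.shortcut VUB).Ir.length)
    (gU₂ : (ℬ.shortcut VUB).Ol.length = (𝒜.shortcut VUA).Il.length) :
    gapInf
        (fun k : (𝒜.seqComp ℬ h₁ h₂).EntrIdx =>
          ((𝒜.shortcut VLA).seqComp (ℬ.shortcut VLB) gL₁ gL₂).achievable
            (Sum.map some some k.1))
        (fun k : (𝒜.seqComp ℬ h₁ h₂).EntrIdx =>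
          ((𝒜.shortcut VUA).seqComp (ℬ.shortcut VUB) gU₁ gU₂).achievable
            (Sum.map some some k.1)) ≤
      (𝒜.exit.length : ℝ≥0∞) *
          gapInf
            (fun k : 𝒜.EntrIdx =>
              dwConv ((VLA k : Finset (𝒜.ExitIdx → ℝ)) : Set (𝒜.ExitIdx → ℝ)))
            (fun k : 𝒜.EntrIdx =>
              dwConv ((VUA k : Finset (𝒜.ExitIdx → ℝ)) : Set (𝒜.ExitIdx → ℝ))) +
        gapInf
          (fun k : ℬ.EntrIdx =>
            dwConv ((VLB k : Finset (ℬ.ExitIdx → ℝ)) : Set (ℬ.ExitIdx → ℝ)))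
          (fun k : ℬ.EntrIdx =>
            dwConv ((VUB k : Finset (ℬ.ExitIdx → ℝ)) : Set (ℬ.ExitIdx → ℝ))) := by
  have hnd := hWFA.2.1
  have hndB := hWFB.2.1
  rw [hAIl, hAOl, List.append_nil, List.append_nil] at hnd
  rw [hBIl, hBOl, List.append_nil, List.append_nil] at hndB
  obtain ⟨-, hndA, hdisjA⟩ := List.nodup_append.1 hnd
  obtain ⟨hndI, -, hdisjB⟩ := List.nodup_append.1 hndB
  have hOr : ∀ e : 𝒜.ExitIdx, e.1 ∈ 𝒜.Or := fun e => by
    simpa [OMDP.exit, hAOl] using e.2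
  have hdisj : ∀ s ∈ ℬ.exit, s ∉ ℬ.entr := fun s hs hs' =>
    hdisjB s (by simpa [OMDP.entr, hBIl] using hs') s (by simpa [OMDP.exit, hBOl] using hs) rfl
  have hneA : ∀ k, (VUA k).Nonempty := fun k => by
    obtain ⟨p, hp⟩ := 𝒜.achievable_nonempty k.1
    obtain ⟨q, hq, -⟩ := (hsoundA k).2 hp
    exact Finset.coe_nonempty.1 (convexHull_nonempty_iff.1 ⟨q, hq⟩)
  have hneB : ∀ k, (VUB k).Nonempty := fun k => by
    obtain ⟨p, hp⟩ := ℬ.achievable_nonempty k.1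
    obtain ⟨q, hq, -⟩ := (hsoundB k).2 hp
    exact Finset.coe_nonempty.1 (convexHull_nonempty_iff.1 ⟨q, hq⟩)
  set l : 𝒜.ExitIdx → ℬ.EntrIdx := fun e =>
    ⟨OMDP.link 𝒜 ℬ h₁ (hOr e), List.mem_append_left _ (OMDP.link_mem _)⟩
  have hinj : Function.Injective l := fun e e' h =>
    Subtype.ext (OMDP.link_injective hndI (hOr e) (hOr e') (congrArg Subtype.val h))
  refine iSup_le fun k => iSup₂_le fun p hp => ?_
  obtain ⟨σ, hσ, hpσ⟩ := hp
  obtain ⟨i, hiA, hk⟩ : ∃ i ∈ 𝒜.Ir, Sum.inl i = k.1 := by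
    simpa [OMDP.entr, OMDP.seqComp, hBIl] using k.2
  dsimp only at hpσ ⊢
  rw [← hk] at hpσ ⊢
  have hi : i ∈ 𝒜.entr := List.mem_append_left _ hiA
  have hi' : i ∉ 𝒜.Or := fun h => hdisjA i hiA i h rfl
  have hexit : ∀ j : ((𝒜.shortcut VUA).seqComp (ℬ.shortcut VUB) gU₁ gU₂).ExitIdx,
      ∃ o : ℬ.ExitIdx, j.1 = Sum.inr (some o.1) := fun j => by
    have := j.2
    simp only [OMDP.exit, OMDP.seqComp, OMDP.shortcut, hAOl, List.map_nil, List.append_nil,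
      List.map_map, List.mem_map] at this
    obtain ⟨o, ho, hj⟩ := this
    exact ⟨⟨o, List.mem_append_left _ ho⟩, hj.symm⟩
  obtain ⟨x, hx, q, hq, hbound⟩ := OMDP.exists_Pr_le_mixture (h₁ := h₁) hndA hBOl hdisj hOr
    (l := l) (fun _ => rfl) hVUA hVUB hi hi' (hneA _) hneB hσ
  have hdown : ∀ v ∈ ((𝒜.shortcut VLA).seqComp (ℬ.shortcut VLB) gL₁ gL₂).achievable
      (Sum.inl (some i)), ∀ q ≤ v, q ∈ ((𝒜.shortcut VLA).seqComp (ℬ.shortcut VLB)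
        gL₁ gL₂).achievable (Sum.inl (some i)) :=
    fun v ⟨τ, hτ, hv⟩ q hqv => ⟨τ, hτ, hqv.trans hv⟩
  have hPropL := OMDP.comp_proper (g₁ := gL₁) (g₂ := gL₂) hVLA hVLB
  rcases isEmpty_or_nonempty 𝒜.ExitIdx with hE | ⟨⟨e₀⟩⟩
  · obtain ⟨τ, hτ⟩ :=
      ((𝒜.shortcut VLA).seqComp (ℬ.shortcut VLB) gL₁ gL₂).M.exists_isSched
    refine le_trans (iInf_edist_le_of_le_add hdown ⟨τ, hτ, le_rfl⟩ le_rfl fun j => ?_)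
      (by simp)
    obtain ⟨o, ho⟩ := hexit j
    have h2 := hbound o
    rw [← ho, Finset.univ_eq_empty, Finset.sum_empty] at h2
    have h3 : 0 ≤ ((𝒜.shortcut VLA).seqComp (ℬ.shortcut VLB) gL₁ gL₂).prVec τ
        (Sum.inl (some i)) j := MDP.Pr_nonneg hPropL hτ _ _
    have h1 := (hpσ j).trans h2
    linarith
  have hlen : 𝒜.exit.length = Fintype.card 𝒜.ExitIdx := by
    have h : 𝒜.exit.Nodup := by rwa [OMDP.exit, hAOl, List.append_nil]
    rw [← List.toFinset_card_of_nodup h]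
    simp [Fintype.card_subtype, ← List.mem_toFinset]
  have hpos : (𝒜.exit.length : ℝ≥0∞) ≠ 0 := by
    rw [hlen]
    exact_mod_cast (Fintype.card_pos_iff.2 ⟨e₀⟩).ne'
  rw [hlen] at hpos ⊢
  set N := Fintype.card 𝒜.ExitIdx
  set γA := gapInf
    (fun k : 𝒜.EntrIdx => dwConv ((VLA k : Finset (𝒜.ExitIdx → ℝ)) : Set (𝒜.ExitIdx → ℝ)))
    (fun k : 𝒜.EntrIdx => dwConv ((VUA k : Finset (𝒜.ExitIdx → ℝ)) : Set (𝒜.ExitIdx → ℝ)))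
    with hγA
  set γB := gapInf
    (fun k : ℬ.EntrIdx => dwConv ((VLB k : Finset (ℬ.ExitIdx → ℝ)) : Set (ℬ.ExitIdx → ℝ)))
    (fun k : ℬ.EntrIdx => dwConv ((VUB k : Finset (ℬ.ExitIdx → ℝ)) : Set (ℬ.ExitIdx → ℝ)))
    with hγB
  refine ENNReal.le_of_forall_pos_le_add fun ε hε hlt => ?_
  obtain ⟨hA, hB⟩ := ENNReal.add_lt_top.1 hlt
  have hA : γA ≠ ⊤ := fun h => by rw [h, ENNReal.mul_top hpos] at hA; exact hA.ne rfl
  have hB : γB ≠ ⊤ := hB.ne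
  set η : ℝ := ε / (N + 1) with hη
  have hη0 : 0 < η := by positivity
  have hltη : ∀ γ : ℝ≥0∞, γ ≠ ⊤ → γ < ENNReal.ofReal (γ.toReal + η) := fun γ hγ => by
    rw [ENNReal.lt_ofReal_iff_toReal_lt hγ]
    linarith
  obtain ⟨x', hx', hxx'⟩ := exists_convexHull_of_gapInf_lt (hltη γA hA) hx
  choose q' hq' hqq' using fun e => exists_convexHull_of_gapInf_lt (hltη γB hB) (hq e)
  obtain ⟨τ, hτ, hτ'⟩ := OMDP.exists_mixture_le_Pr (g₁ := gL₁) (g₂ := gL₂) (h₁ := h₁) hndA hBOl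
    hdisj hOr (l := l) (fun _ => rfl) hinj hVLA hVLB hi hi' hx' hq'
  have hδA : 0 ≤ γA.toReal + η := by positivity
  have hδB : 0 ≤ γB.toReal + η := by positivity
  refine le_trans (iInf_edist_le_of_le_add hdown ⟨τ, hτ, le_rfl⟩
    (D := N * (γA.toReal + η) + (γB.toReal + η)) (by positivity) fun j => ?_) (le_of_eq ?_)
  · obtain ⟨o, ho⟩ := hexit j
    have hqs := fun e => OMDP.subdist_of_mem_convexHull (hVUB (l e)) (hq e)
    have h1 := hpσ j
    have h2 := hbound o
    have h3 := hτ' o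
    rw [← ho] at h2 h3
    have h4 := mixture_le_add hδA hδB (OMDP.subdist_of_mem_convexHull (hVLA ⟨i, hi⟩) hx')
      (fun e => (hqs e).1 o)
      (fun e => (Finset.single_le_sum (fun o _ => (hqs e).1 o) (Finset.mem_univ o)).trans
        (hqs e).2) hxx' (fun e => hqq' e o)
    exact ((h1.trans h2).trans h4).trans (add_le_add_left h3 _)
  · have hD : (N : ℝ) * (γA.toReal + η) + (γB.toReal + η) =
        N * γA.toReal + γB.toReal + ε := by
      rw [hη]
      field_simp
      ring
    rw [hD, ENNReal.ofReal_add (by positivity) (by positivity),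
      ENNReal.ofReal_add (by positivity) (by positivity), ENNReal.ofReal_mul (by positivity),
      ENNReal.ofReal_toReal hA, ENNReal.ofReal_toReal hB]
    simp
end

section
/- Let M₁=(S,P₁) and M₂=(S,P₂) be Markov chains on the same finite state set S, and let s ∈ S be a sink (absorbing) state of both M₁ and M₂. If P₁(s₁)(s₂) ≤ P₂(s₁)(s₂) for all s₁, s₂ ∈ S \ {s}, then the reachability probabilities satisfy Pr^{M₁}(s₁ ⊨ ◇s₂) ≤ Pr^{M₂}(s₁ ⊨ ◇s₂) for all s₁, s₂ ∈ S \ {s}. -/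
open scoped Classical

namespace SD

/-- A Markov chain with finite state set: a transition function. -/
structure MC (S : Type) : Type where
  P : S → S → ℝ

namespace MC

variable {S : Type} [Fintype S]

/-- The transition function consists of probability distributions. -/
def Proper (M : MC S) : Prop :=
  (∀ s s', 0 ≤ M.P s s') ∧ ∀ s, ∑ s', M.P s s' = 1

/-- The state `t` is a sink (absorbing): it transitions to itself with probability 1. -/
def Sink (M : MC S) (t : S) : Prop := M.P t t = 1

/-- Probability of visiting `t` within `n` steps, starting from `s`. -/
noncomputable def reachN (M : MC S) (t : S) : ℕ → S → ℝ
  | 0, s => if s = t then 1 else 0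
  | n + 1, s => if s = t then 1 else ∑ s', M.P s s' * reachN M t n s'

/-- `Pr^M(s ⊨ ◇t)`: the probability, under the standard measure on infinite paths
started at `s`, of the paths that visit `t`; it is the supremum of the
bounded-horizon reachability probabilities. -/
noncomputable def Pr (M : MC S) (s t : S) : ℝ := ⨆ n : ℕ, M.reachN t n s

end MC

end SD

namespace SD

namespace MC

variable {S : Type} [Fintype S]

theorem Proper.reachN_nonneg {M : MC S} (h : M.Proper) (t : S) (n : ℕ) (u : S) :
    0 ≤ M.reachN t n u := by
  induction n generalizing u with
  | zero => unfold reachN; split_ifs <;> norm_num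
  | succ n ih =>
    unfold reachN
    split_ifs
    · norm_num
    · exact Finset.sum_nonneg fun v _ => mul_nonneg (h.1 u v) (ih v)

theorem Proper.reachN_le_one {M : MC S} (h : M.Proper) (t : S) (n : ℕ) (u : S) :
    M.reachN t n u ≤ 1 := by
  induction n generalizing u with
  | zero => unfold reachN; split_ifs <;> norm_num
  | succ n ih =>
    unfold reachN
    split_ifs
    · exact le_rfl
    · calc ∑ v, M.P u v * M.reachN t n v ≤ ∑ v, M.P u v :=
            Finset.sum_le_sum fun v _ => mul_le_of_le_one_right (h.1 u v) (ih v)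
        _ = 1 := h.2 u

theorem Proper.eq_zero_of_sink {M : MC S} (h : M.Proper) {s v : S} (hs : M.Sink s)
    (hv : v ≠ s) : M.P s v = 0 := by
  have hsum := h.2 s
  rw [← Finset.add_sum_erase _ _ (Finset.mem_univ s), hs, add_eq_left] at hsum
  exact (Finset.sum_eq_zero_iff_of_nonneg fun w _ => h.1 s w).1 hsum v
    (Finset.mem_erase.2 ⟨hv, Finset.mem_univ v⟩)

theorem Proper.reachN_sink {M : MC S} (h : M.Proper) {s t : S} (hs : M.Sink s)
    (ht : t ≠ s) (n : ℕ) : M.reachN t n s = 0 := by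
  induction n with
  | zero => simp [reachN, ht.symm]
  | succ n ih =>
    rw [reachN, if_neg ht.symm]
    refine Finset.sum_eq_zero fun v _ => ?_
    by_cases hv : v = s
    · rw [hv, ih, mul_zero]
    · rw [h.eq_zero_of_sink hs hv, zero_mul]

theorem reachN_le_reachN {M₁ M₂ : MC S} (h₁ : M₁.Proper) (h₂ : M₂.Proper) {s : S}
    (hs₁ : M₁.Sink s) (hs₂ : M₂.Sink s)
    (hle : ∀ u v, u ≠ s → v ≠ s → M₁.P u v ≤ M₂.P u v) {t : S} (ht : t ≠ s)
    (n : ℕ) (u : S) : M₁.reachN t n u ≤ M₂.reachN t n u := by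
  induction n generalizing u with
  | zero => exact le_rfl
  | succ n ih =>
    by_cases hu : u = s
    · rw [hu, h₁.reachN_sink hs₁ ht, h₂.reachN_sink hs₂ ht]
    unfold reachN
    split_ifs
    · exact le_rfl
    refine Finset.sum_le_sum fun v _ => ?_
    by_cases hv : v = s
    · rw [hv, h₁.reachN_sink hs₁ ht, h₂.reachN_sink hs₂ ht, mul_zero, mul_zero]
    · exact mul_le_mul (hle u v hu hv) (ih v) (h₁.reachN_nonneg t n v) (h₂.1 u v)

end MC

end SD

open SD in
/-- Let `M₁ = (S,P₁)` and `M₂ = (S,P₂)` be Markov chains on the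
same finite state set `S`, and let `s ∈ S` be a sink (absorbing) state of both.
If `P₁(s₁)(s₂) ≤ P₂(s₁)(s₂)` for all `s₁, s₂ ∈ S \ {s}`, then
`Pr^{M₁}(s₁ ⊨ ◇s₂) ≤ Pr^{M₂}(s₁ ⊨ ◇s₂)` for all `s₁, s₂ ∈ S \ {s}`. -/
theorem statement_17 {S : Type} [Fintype S] (M₁ M₂ : MC S)
    (h₁ : M₁.Proper) (h₂ : M₂.Proper)
    (s : S) (hs₁ : M₁.Sink s) (hs₂ : M₂.Sink s)
    (hle : ∀ s₁ s₂, s₁ ≠ s → s₂ ≠ s → M₁.P s₁ s₂ ≤ M₂.P s₁ s₂) :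
    ∀ s₁ s₂, s₁ ≠ s → s₂ ≠ s → M₁.Pr s₁ s₂ ≤ M₂.Pr s₁ s₂ := by
  intro s₁ s₂ _ ht
  exact ciSup_mono ⟨1, by rintro _ ⟨n, rfl⟩; exact h₂.reachN_le_one s₂ n s₁⟩
    fun n => MC.reachN_le_reachN h₁ h₂ hs₁ hs₂ hle ht n s₁
end
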